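/- Let q be an odd prime power, h an even positive integer with (q+1)/h = 2τ+1 for some integer τ ≥ 1, let r be an odd integer with h < r < 3h/2, set n = r(q^2−1)/(2h), and let k be an integer with 1 ≤ k and 2hk ≤ (r+2)(q+1) − 3h. Then there exist pairwise distinct elements a_1,…,a_n of F_{q^2} and nonzero elements v_1,…,v_n of F_{q^2} such that Σ_{l=1}^n v_l^{q+1} a_l^{q·i+j} = 0 for all integers 0 ≤ i, j ≤ k−1 (with the convention 0^0 = 1); that is, the generalized Reed–Solomon code GRS_k(a,v) is a Hermitian self-orthogonal [n, k, n−k+1] MDS code over F_{q^2}, which by the Hermitian construction yields an [[n, n−2k, k+1]]_q quantum MDS code. -/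

import Mathlib

open Finset

theorem exists_forall_add_mul_ne_zero {F ι : Type*} [Field F] [Fintype F] (s : Finset ι)
    (hs : #s < Fintype.card F) (u w : ι → F) (h : ∀ i ∈ s, u i ≠ 0 ∨ w i ≠ 0) :
    ∃ x : F, ∀ i ∈ s, u i + x * w i ≠ 0 := by
  classical
  by_contra! hx
  have : (univ : Finset F) ⊆ s.image fun i => -u i / w i := by
    intro x _
    obtain ⟨i, hi, hxi⟩ := hx x
    have hw : w i ≠ 0 := by
      rintro hw
      rcases h i hi with h | h
      · simp [hw] at hxi; exact h hxi
      · exact h hw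
    refine mem_image.2 ⟨i, hi, ?_⟩
    rw [div_eq_iff hw]
    linear_combination -hxi
  have := (card_le_card this).trans card_image_le
  rw [card_univ] at this
  omega

theorem exists_weights_sum_mul_pow_eq_zero {F ι : Type*} [Field F] (s : Finset ι) (v : ι → F)
    (hv : Set.InjOn v s) :
    ∃ l : ι → F, (∀ i ∈ s, l i ≠ 0) ∧ ∀ j, j + 1 < #s → ∑ i ∈ s, l i * v i ^ j = 0 := by
  classical
  refine ⟨Lagrange.nodalWeight s v, fun i hi => Lagrange.nodalWeight_ne_zero hv hi, fun j hj => ?_⟩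
  have h := Lagrange.coeff_eq_sum (P := (Polynomial.X ^ j : Polynomial F)) hv (by
    rw [Polynomial.degree_X_pow]; exact_mod_cast (by omega : j < #s))
  rw [Polynomial.coeff_X_pow, if_neg (by omega)] at h
  rw [h]
  refine sum_congr rfl fun i _ => ?_
  simp [Lagrange.nodalWeight, prod_inv_distrib, div_eq_mul_inv, mul_comm]

theorem exists_pow_succ_eq_of_pow_eq {F : Type*} [Field F] [Fintype F] {q : ℕ} (hq : 1 < q)
    (hF : Fintype.card F = q ^ 2) {ω : F} (hω : IsPrimitiveRoot ω (q ^ 2 - 1)) {w : F} (hw : w ≠ 0)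
    (hwq : w ^ q = w) : ∃ v : F, v ≠ 0 ∧ v ^ (q + 1) = w := by
  have hfac : q ^ 2 - 1 = (q + 1) * (q - 1) := by simpa using Nat.sq_sub_sq q 1
  have hpos : 0 < q ^ 2 - 1 := by rw [hfac]; exact Nat.mul_pos (by omega) (by omega)
  have : NeZero (q ^ 2 - 1) := ⟨hpos.ne'⟩
  obtain ⟨e, -, rfl⟩ := hω.eq_pow_of_pow_eq_one (ξ := w) (by
    rw [← hF]; exact FiniteField.pow_card_sub_one_eq_one w hw)
  have h1 : (ω ^ e) ^ (q - 1) = 1 := by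
    have : (ω ^ e) ^ (q - 1) * ω ^ e = 1 * ω ^ e := by
      rw [← pow_succ, Nat.sub_add_cancel hq.le, hwq, one_mul]
    exact mul_right_cancel₀ hw this
  rw [← pow_mul] at h1
  have h2 := hω.dvd_of_pow_eq_one _ h1
  rw [hfac] at h2
  obtain ⟨f, rfl⟩ := Nat.dvd_of_mul_dvd_mul_right (by omega) h2
  refine ⟨ω ^ f, pow_ne_zero _ (hω.ne_zero hpos.ne'), ?_⟩
  rw [← pow_mul, mul_comm]

theorem exists_fixed_of_sum_mul_pow_eq_zero {F : Type*} [Field F] [Fintype F] {q : ℕ}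
    (hq : IsPrimePow q) (hF : Fintype.card F = q ^ 2) (S : Finset ℕ) (hS : #S < q)
    (ω : F) (A : Set ℕ) (hA : ∀ N ∈ A, ∃ N' ∈ A, ω ^ (q * N') = ω ^ N) (u : ℕ → F)
    (hu : ∀ s ∈ S, u s ≠ 0) (hsum : ∀ N ∈ A, ∑ s ∈ S, u s * (ω ^ N) ^ s = 0) :
    ∃ w : ℕ → F, (∀ s ∈ S, w s ≠ 0) ∧ (∀ s, w s ^ q = w s) ∧
      ∀ N ∈ A, ∑ s ∈ S, w s * (ω ^ N) ^ s = 0 := by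
  classical
  have hq1 : 1 < q := hq.one_lt
  have hqq : ∀ x : F, (x ^ q) ^ q = x := fun x => by
    rw [← pow_mul, ← sq, ← hF, FiniteField.pow_card]
  obtain ⟨φ, hφ⟩ : ∃ φ : F →+* F, ∀ x, φ x = x ^ q := by
    obtain ⟨p, a, hp, ha, rfl⟩ := hq
    have hp' := hp.nat_prime
    have : Fact p.Prime := ⟨hp'⟩
    have : CharP F p := by
      obtain ⟨p', hc⟩ := CharP.exists F
      obtain ⟨b, hb, hcard⟩ := FiniteField.card F p'
      have : p = p' := by
        have h1 : p ∣ p' ^ (b : ℕ) := by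
          rw [← hcard, hF, ← pow_mul]; exact dvd_pow_self _ (by omega)
        exact (Nat.prime_dvd_prime_iff_eq hp' hb).1 (hp'.dvd_of_dvd_pow h1)
      rwa [this]
    exact ⟨iterateFrobenius F p a, fun x => iterateFrobenius_def p a x⟩
  obtain ⟨x, hx⟩ : ∃ x : F, ∀ s ∈ S, x * u s + (x * u s) ^ q ≠ 0 := by
    by_contra! hx
    have hsub : (univ : Finset F) ⊆ S.biUnion fun s =>
        ((Polynomial.X ^ q + Polynomial.X : Polynomial F).roots.toFinset).image
          fun y => y / u s := by
      intro x _
      obtain ⟨s, hs, h⟩ := hx x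
      refine mem_biUnion.2 ⟨s, hs, mem_image.2 ⟨x * u s, ?_, by field_simp [hu s hs]⟩⟩
      rw [Multiset.mem_toFinset, Polynomial.mem_roots]
      · simp [← h, add_comm]
      · exact (Polynomial.monic_X_pow_add (n := q) (by
          rw [Polynomial.degree_X]; exact_mod_cast hq1)).ne_zero
    have h1 := (card_le_card hsub).trans (card_biUnion_le_card_mul S _ q fun s _ => by
      refine card_image_le.trans ((Multiset.toFinset_card_le _).trans ?_)
      refine (Polynomial.card_roots' _).trans ?_
      compute_degree
      omega)
    rw [card_univ, hF, sq] at h1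
    have := Nat.le_of_mul_le_mul_right h1 (by omega)
    omega
  refine ⟨fun s => x * u s + (x * u s) ^ q, hx, fun s => ?_, fun N hN => ?_⟩
  · simp only [← hφ, map_add]
    simp only [hφ, hqq]
    ring
  · obtain ⟨N', hN', h⟩ := hA N hN
    have h1 : ∑ s ∈ S, (x * u s) ^ q * (ω ^ N) ^ s = (x * ∑ s ∈ S, u s * (ω ^ N') ^ s) ^ q := by
      rw [← hφ, mul_sum, map_sum]
      refine sum_congr rfl fun s _ => ?_
      rw [hφ, ← h]
      ring
    simp only [add_mul, sum_add_distrib, h1, hsum N' hN', mul_assoc, ← mul_sum, hsum N hN]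
    simp [show q ≠ 0 by omega]

theorem exists_weights_range {F : Type*} [Field F] {m : ℕ} {ζ : F} (hζ : IsPrimitiveRoot ζ m)
    {r : ℕ} (hr : r ≤ m) (α : ℤ) :
    ∃ u : ℕ → F, (∀ s ∈ range r, u s ≠ 0) ∧
      ∀ c : ℤ, α ≤ c → c + 1 < α + r → ∑ s ∈ range r, u s * ζ ^ ((s : ℤ) * c) = 0 := by
  rcases Nat.eq_zero_or_pos m with rfl | hm
  · obtain rfl : r = 0 := by omega
    simp
  have hζ0 : ζ ≠ 0 := hζ.ne_zero hm.ne'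
  obtain ⟨l, hl, hsum⟩ := exists_weights_sum_mul_pow_eq_zero (range r) (fun s => ζ ^ s)
    (fun s hs t ht h => hζ.pow_inj ((mem_range.1 hs).trans_le hr) ((mem_range.1 ht).trans_le hr) h)
  refine ⟨fun s => l s * ζ ^ (-((s : ℤ) * α)), fun s hs => mul_ne_zero (hl s hs)
    (zpow_ne_zero _ hζ0), fun c hc hc' => ?_⟩
  obtain ⟨i, rfl⟩ := Int.le.dest hc
  rw [← hsum i (by rw [card_range]; omega)]
  refine sum_congr rfl fun s _ => ?_
  rw [mul_assoc, ← zpow_add₀ hζ0, ← pow_mul, ← zpow_natCast]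
  congr 2
  push_cast
  ring

theorem pow_two_mul_eq_neg_one {F : Type*} [Field F] {H : ℕ} (hH : 0 < H) {ζ : F}
    (hζ : IsPrimitiveRoot ζ (4 * H)) : ζ ^ (2 * H) = -1 := by
  have h : IsPrimitiveRoot (ζ ^ (2 * H)) 2 := hζ.pow (by omega) (by ring)
  exact h.eq_neg_one_of_two_right

theorem exists_weights_of_two_le {F : Type*} [Field F] [Fintype F] (h2 : (2 : F) ≠ 0) {H d : ℕ}
    (hd : 2 ≤ d) (hdH : 2 * d ≤ H) {ζ : F} (hζ : IsPrimitiveRoot ζ (4 * H))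
    (hcard : 2 * H + 2 * d < Fintype.card F) :
    ∃ S ⊆ range (4 * H), #S = 2 * H + 2 * d - 1 ∧ ∃ u : ℕ → F, (∀ s ∈ S, u s ≠ 0) ∧
      ∀ c : ℤ, (Even c ∧ -(2 * (d : ℤ) - 2) ≤ c ∧ c ≤ 2 * (d : ℤ) - 2 ∨
          Odd c ∧ 1 ≤ c ∧ c ≤ 2 * (H : ℤ) - 1 ∨ c = 2 * (H : ℤ)) →
        ∑ s ∈ S, u s * ζ ^ ((s : ℤ) * c) = 0 := by
  classical
  have hζ0 : ζ ≠ 0 := hζ.ne_zero (by omega)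
  have hhalf : ζ ^ (2 * H) = -1 := pow_two_mul_eq_neg_one (by omega) hζ
  obtain ⟨W, hEW, hWr, hWc⟩ : ∃ W, (range H).image (2 * ·) ⊆ W ∧ W ⊆ range (2 * H) ∧
      #W = H + d := by
    refine exists_subsuperset_card_eq (fun s hs => ?_) ?_ ?_
    · simp only [mem_image, mem_range] at hs ⊢
      omega
    · exact card_image_le.trans (by rw [card_range]; omega)
    · rw [card_range]; omega
  have h0W : 0 ∈ W := hEW (mem_image.2 ⟨0, by simp; omega, rfl⟩)
  have hinj : Set.InjOn (fun s : ℕ => (ζ ^ 2) ^ s) W := fun s hs t ht h => by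
    have hs' := mem_range.1 (hWr hs)
    have ht' := mem_range.1 (hWr ht)
    simp only [← pow_mul] at h
    have := hζ.pow_inj (by omega) (by omega) h
    omega
  obtain ⟨l, hl, hlsum⟩ := exists_weights_sum_mul_pow_eq_zero W _ hinj
  obtain ⟨μ, hμ, hμsum⟩ := exists_weights_sum_mul_pow_eq_zero (W.erase 0) _
    (hinj.mono (coe_subset.2 (erase_subset 0 W)))
  rw [hWc] at hlsum
  rw [card_erase_of_mem h0W, hWc] at hμsum
  set P : ℕ → F := fun s => if Even s then ζ ^ (2 * d * s) else 0 with hP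
  set D : ℕ → F := fun s => l s / l 0 * ζ ^ (-(s : ℤ)) with hD
  set E : ℕ → F := fun s => if s = 0 then 0 else μ s * ζ ^ (-(s : ℤ)) with hE
  have key : ∀ (V : Finset ℕ) (f : ℕ → F) (x : F) (c : ℤ), Odd c → 1 ≤ c → c ≤ 2 * (H : ℤ) - 1 →
      (∀ j, j < H → ∑ s ∈ V, f s * ((ζ ^ 2) ^ s) ^ j = 0) →
      ∑ s ∈ V, f s / x * ζ ^ (-(s : ℤ)) * ζ ^ ((s : ℤ) * c) = 0 := by
    intro V f x c hc h1 h3 h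
    obtain ⟨b, rfl⟩ := hc
    lift b to ℕ using by omega
    have := h b (by omega)
    calc _ = (∑ s ∈ V, f s * ((ζ ^ 2) ^ s) ^ b) / x := by
          rw [sum_div]
          refine sum_congr rfl fun s _ => ?_
          rw [mul_assoc, ← zpow_add₀ hζ0, ← pow_mul, ← pow_mul, ← zpow_natCast, div_mul_eq_mul_div]
          congr 3
          push_cast
          ring
      _ = 0 := by rw [this, zero_div]
  have hDsum : ∀ c : ℤ, Odd c → 1 ≤ c → c ≤ 2 * (H : ℤ) - 1 →
      ∑ s ∈ W, D s * ζ ^ ((s : ℤ) * c) = 0 := fun c hc h1 h3 =>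
    key W l (l 0) c hc h1 h3 fun j hj => hlsum j (by omega)
  have hEsum : ∀ c : ℤ, Odd c → 1 ≤ c → c ≤ 2 * (H : ℤ) - 1 →
      ∑ s ∈ W, E s * ζ ^ ((s : ℤ) * c) = 0 := fun c hc h1 h3 => by
    rw [← add_sum_erase W _ h0W, ← key (W.erase 0) μ 1 c hc h1 h3 fun j hj => hμsum j (by omega)]
    simp only [hE, if_true, zero_mul, zero_add, div_one]
    refine sum_congr rfl fun s hs => ?_
    rw [if_neg (mem_erase.1 hs).1]
  have hPsum : ∀ c : ℤ, Even c → ¬ (2 * (H : ℤ) ∣ 2 * d + c) →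
      ∑ s ∈ W, P s * ζ ^ ((s : ℤ) * c) = 0 := by
    intro c hc hdvd
    have h1 : ∑ s ∈ W, P s * ζ ^ ((s : ℤ) * c) =
        ∑ s ∈ range H, (ζ ^ (2 * (2 * d + c))) ^ s := by
      rw [← sum_subset hEW, sum_image (fun a _ b _ h => by simpa using h)]
      · refine sum_congr rfl fun s _ => ?_
        simp only [hP]
        rw [if_pos ⟨s, by ring⟩, ← zpow_natCast, ← zpow_add₀ hζ0, ← zpow_natCast, ← zpow_mul]
        congr 1
        push_cast
        ring
      · intro s hs hs'
        have : ¬ Even s := by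
          rintro ⟨t, rfl⟩
          refine hs' (mem_image.2 ⟨t, ?_, by ring⟩)
          have := mem_range.1 (hWr hs)
          rw [mem_range]
          omega
        simp [hP, this]
    rw [h1]
    have hne : ζ ^ (2 * (2 * d + c)) ≠ 1 := by
      intro h
      rw [hζ.zpow_eq_one_iff_dvd] at h
      apply hdvd
      obtain ⟨y, hy⟩ := h
      exact ⟨y, by push_cast at hy; linarith⟩
    refine (mul_eq_zero.1 (geom_sum_mul (ζ ^ (2 * (2 * d + c))) H ▸ ?_)).resolve_right
      (sub_ne_zero.2 hne)
    rw [sub_eq_zero, ← zpow_natCast, ← zpow_mul, hζ.zpow_eq_one_iff_dvd]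
    obtain ⟨b, rfl⟩ := hc
    exact ⟨d + b, by push_cast; ring⟩
  let T := W ∪ (W.erase 0).image (· + 2 * H)
  let fold : (ℕ → F) → (ℕ → F) → ℕ → F := fun p g s =>
    if s < 2 * H then p s + g s else p (s - 2 * H) - g (s - 2 * H)
  have hdisj : Disjoint W ((W.erase 0).image (· + 2 * H)) := by
    rw [disjoint_left]
    intro s hs hs'
    have := mem_range.1 (hWr hs)
    obtain ⟨t, -, rfl⟩ := mem_image.1 hs'
    omega
  have hTcard : #T = 2 * H + 2 * d - 1 := by
    rw [card_union_of_disjoint hdisj, card_image_of_injective _ (add_left_injective _),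
      card_erase_of_mem h0W, hWc]
    omega
  have hfold : ∀ (p g : ℕ → F) (c : ℤ), p 0 = g 0 →
      (Even c → ∑ s ∈ W, p s * ζ ^ ((s : ℤ) * c) = 0) →
      (Odd c → ∑ s ∈ W, g s * ζ ^ ((s : ℤ) * c) = 0) →
      ∑ s ∈ T, fold p g s * ζ ^ ((s : ℤ) * c) = 0 := by
    intro p g c hpg hp hg
    have hsgn : ζ ^ (2 * H * c) = (-1) ^ c := by
      rw [zpow_mul, ← hhalf]
      norm_cast
    have e1 : ∑ s ∈ (W.erase 0).image (· + 2 * H), fold p g s * ζ ^ ((s : ℤ) * c) =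
        ∑ s ∈ W, (-1) ^ c * ((p s - g s) * ζ ^ ((s : ℤ) * c)) := by
      rw [sum_image (fun a _ b _ h => by simpa using h), ← add_sum_erase W _ h0W]
      simp only [hpg, sub_self, zero_mul, mul_zero, zero_add]
      refine sum_congr rfl fun s _ => ?_
      simp only [fold]
      rw [if_neg (by omega), Nat.add_sub_cancel, ← hsgn, mul_left_comm, ← zpow_add₀ hζ0]
      congr 2
      push_cast
      ring
    have e2 : ∑ s ∈ W, fold p g s * ζ ^ ((s : ℤ) * c) =
        ∑ s ∈ W, (p s + g s) * ζ ^ ((s : ℤ) * c) := by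
      refine sum_congr rfl fun s hs => ?_
      simp only [fold]
      rw [if_pos (mem_range.1 (hWr hs))]
    rw [sum_union hdisj, e1, e2, ← mul_sum]
    simp only [add_mul, sub_mul, sum_add_distrib, sum_sub_distrib]
    rcases Int.even_or_odd c with hc | hc
    · rw [hp hc, hc.neg_one_zpow]; ring
    · rw [hg hc, hc.neg_one_zpow]; ring
  have hl0 := hl 0 h0W
  have hE0 : ∀ s ∈ W.erase 0, E s ≠ 0 := fun s hs => by
    simp only [hE]
    rw [if_neg (mem_erase.1 hs).1]
    exact mul_ne_zero (hμ s hs) (zpow_ne_zero _ hζ0)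
  obtain ⟨x, hx⟩ := exists_forall_add_mul_ne_zero T (by omega) (fold P D) (fold 0 E) (by
    intro s hs
    rcases mem_union.1 hs with hs | hs
    · have := mem_range.1 (hWr hs)
      simp only [fold]
      rw [if_pos this, if_pos this]
      by_cases h0 : s = 0
      · subst h0
        left
        simp [hP, hD, hl0]
        norm_num
        exact h2
      · right
        simpa using hE0 s (mem_erase.2 ⟨h0, hs⟩)
    · obtain ⟨t, ht, rfl⟩ := mem_image.1 hs
      right
      simp only [fold]
      rw [if_neg (by omega)]
      simpa using hE0 t ht)
  refine ⟨T, union_subset (fun s hs => ?_) (fun s hs => ?_), hTcard, _, hx, fun c hc => ?_⟩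
  · have := mem_range.1 (hWr hs)
    rw [mem_range]
    omega
  · obtain ⟨t, ht, rfl⟩ := mem_image.1 hs
    have := mem_range.1 (hWr (mem_erase.1 ht).2)
    rw [mem_range]
    omega
  · have hodd : Odd c → 1 ≤ c ∧ c ≤ 2 * (H : ℤ) - 1 := by
      intro h
      rcases hc with ⟨h', -⟩ | ⟨-, h'⟩ | rfl
      · exact absurd h' (Int.not_even_iff_odd.2 h)
      · exact h'
      · exact absurd h (by simp)
    have heven : Even c → ¬ (2 * (H : ℤ) ∣ 2 * d + c) := by
      rintro h ⟨y, hy⟩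
      rcases hc with ⟨-, h3, h4⟩ | ⟨h', -⟩ | rfl
      · rcases lt_or_ge 0 y with hy0 | hy0 <;> nlinarith
      · exact absurd h (Int.not_even_iff_odd.2 h')
      · rcases lt_or_ge 1 y with hy0 | hy0 <;> nlinarith
    have e1 := hfold P D c (by simp [hP, hD, hl0]) (fun h => hPsum c h (heven h))
      (fun h => hDsum c h (hodd h).1 (hodd h).2)
    have e2 := hfold 0 E c (by simp [hE]) (fun _ => by simp)
      (fun h => hEsum c h (hodd h).1 (hodd h).2)
    simp only [add_mul, sum_add_distrib, mul_assoc, ← mul_sum, e1, e2]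
    simp

theorem exists_weights_of_eq_two {F : Type*} [Field F] (h2 : (2 : F) ≠ 0) {ζ : F}
    (hζ : IsPrimitiveRoot ζ (4 * 2)) :
    ∃ u : ℕ → F, (∀ s ∈ range 5, u s ≠ 0) ∧
      ∀ c : ℤ, c = 0 ∨ c = 1 ∨ c = 3 ∨ c = 4 → ∑ s ∈ range 5, u s * ζ ^ ((s : ℤ) * c) = 0 := by
  have h4 : ζ ^ 4 = -1 := pow_two_mul_eq_neg_one (by norm_num) hζ
  have hw : ζ + ζ ^ 3 ≠ 0 := by
    intro h
    apply h2
    linear_combination (-ζ - ζ ^ 3) * h + (2 + ζ ^ 2) * h4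
  refine ⟨fun s => if s = 0 then 1 else if s = 1 then ζ + ζ ^ 3 else if s = 2 then -2 else
    if s = 3 then -(ζ + ζ ^ 3) else 1, fun s hs => ?_, fun c hc => ?_⟩
  · dsimp only
    have := neg_ne_zero.2 hw
    have := neg_ne_zero.2 h2
    split_ifs <;> first | assumption | exact one_ne_zero
  · rcases hc with rfl | rfl | rfl | rfl <;> simp [sum_range_succ] <;> grind

theorem exists_weights_of_eq_three {F : Type*} [Field F] [Fintype F] (h2 : (2 : F) ≠ 0) {ζ : F}
    (hζ : IsPrimitiveRoot ζ (4 * 3)) (hcard : 7 < Fintype.card F) :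
    ∃ u : ℕ → F, (∀ s ∈ range 7, u s ≠ 0) ∧
      ∀ c : ℤ, c = 0 ∨ c = 1 ∨ c = 3 ∨ c = 5 ∨ c = 6 →
        ∑ s ∈ range 7, u s * ζ ^ ((s : ℤ) * c) = 0 := by
  have h6 : ζ ^ 6 = -1 := pow_two_mul_eq_neg_one (by norm_num) hζ
  have hζ0 : ζ ≠ 0 := hζ.ne_zero (by norm_num)
  have h4 : ζ ^ 4 = ζ ^ 2 - 1 := by
    have hne : ζ ^ 2 + 1 ≠ 0 := by
      intro h
      refine hζ.pow_ne_one_of_pos_of_lt (l := 4) (by norm_num) (by norm_num) ?_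
      linear_combination (ζ ^ 2 - 1) * h
    apply mul_left_cancel₀ hne
    linear_combination h6
  have h3 : (3 : F) ≠ 0 := by
    intro h
    have : (ζ ^ 2 + 1) ^ 2 = 0 := by linear_combination h4 + ζ ^ 2 * h
    have h' := pow_eq_zero_iff (two_ne_zero) |>.1 this
    refine hζ.pow_ne_one_of_pos_of_lt (l := 4) (by norm_num) (by norm_num) ?_
    linear_combination (ζ ^ 2 - 1) * h'
  let g : ℕ → F := fun s => if s = 0 then -ζ ^ 3 else if s = 1 then 2 else
    if s = 2 then 3 * ζ ^ 3 else if s = 3 then -3 else if s = 4 then -2 * ζ ^ 3 else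
    if s = 5 then 1 else 0
  let f : ℕ → F := fun s => if s = 0 then 0 else g (s - 1)
  obtain ⟨x, hx⟩ := exists_forall_add_mul_ne_zero (range 7) (by simpa using hcard) g f (by
    intro s hs
    rw [mem_range] at hs
    interval_cases s <;> simp [g, f, h2, h3, hζ0])
  refine ⟨_, hx, fun c hc => ?_⟩
  have e1 : ∑ s ∈ range 7, g s * ζ ^ ((s : ℤ) * c) = 0 := by
    rcases hc with rfl | rfl | rfl | rfl | rfl <;> simp [sum_range_succ, g] <;> grind
  have e2 : ∑ s ∈ range 7, f s * ζ ^ ((s : ℤ) * c) = 0 := by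
    rcases hc with rfl | rfl | rfl | rfl | rfl <;>
      simp [sum_range_succ, f, g] <;> grind
  simp only [add_mul, sum_add_distrib, mul_assoc, ← mul_sum, e1, e2]
  simp

theorem exists_weights_of_le_two_mul_add_one {F : Type*} [Field F] [Fintype F] (h2 : (2 : F) ≠ 0)
    {H d : ℕ} (hH : 2 ≤ H) (hdH : 2 * d ≤ H) (hdH' : H ≤ 2 * d + 1) {ζ : F}
    (hζ : IsPrimitiveRoot ζ (4 * H)) (hcard : 2 * H + 2 * d < Fintype.card F) :
    ∃ S ⊆ range (4 * H), #S = 2 * H + 2 * d - 1 ∧ ∃ u : ℕ → F, (∀ s ∈ S, u s ≠ 0) ∧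
      ∀ c : ℤ, (Even c ∧ -(2 * (d : ℤ) - 2) ≤ c ∧ c ≤ 2 * (d : ℤ) - 2 ∨
          Odd c ∧ 1 ≤ c ∧ c ≤ 2 * (H : ℤ) - 1 ∨ c = 2 * (H : ℤ)) →
        ∑ s ∈ S, u s * ζ ^ ((s : ℤ) * c) = 0 := by
  rcases Nat.lt_or_ge d 2 with hd | hd
  · obtain rfl : d = 1 := by omega
    obtain rfl | rfl : H = 2 ∨ H = 3 := by omega
    · obtain ⟨u, hu, hsum⟩ := exists_weights_of_eq_two h2 hζ
      exact ⟨range 5, by simp, by simp, u, hu, fun c hc => hsum c (by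
        simp only [Int.odd_iff] at hc
        omega)⟩
    · obtain ⟨u, hu, hsum⟩ := exists_weights_of_eq_three h2 hζ (by omega)
      exact ⟨range 7, by simp, by simp, u, hu, fun c hc => hsum c (by
        simp only [Int.odd_iff] at hc
        omega)⟩
  · exact exists_weights_of_two_le h2 hd hdH hζ hcard

theorem exists_eq_of_mul_add_sub_eq {H ρ i j s c : ℤ} (hρ : ρ ≠ 0) (hQ : H * ρ - 1 ≠ 0)
    (h : (2 * H * ρ - 1) * i + j - 2 * H * ρ * s = c * (ρ * (H * ρ - 1))) :
    ∃ e M, j - i = ρ * e ∧ i + j = (H * ρ - 1) * M + 2 * s ∧ c = H * M - e := by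
  have h1 : ρ ∣ j - i := by
    refine ⟨c * (H * ρ - 1) - 2 * H * i + 2 * H * s, ?_⟩
    linear_combination h
  obtain ⟨e, he⟩ := h1
  have h2 : H * (i + j - 2 * s) = (H * ρ - 1) * (c + e) := by
    apply mul_left_cancel₀ hρ
    linear_combination h + (H * ρ - 1) * he
  have h3 : H * ρ - 1 ∣ i + j - 2 * s :=
    ⟨ρ * (c + e) - (i + j - 2 * s), by linear_combination ρ * h2⟩
  obtain ⟨M, hM⟩ := h3
  refine ⟨e, M, he, by linear_combination hM, ?_⟩
  apply mul_left_cancel₀ hQ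
  linear_combination -h2 + H * hM

theorem bounds_of_two_mul_add_two_le {H d τ i j e M : ℤ} (hτ : 1 ≤ τ) (hd : 1 ≤ d)
    (hdH : 2 * d + 2 ≤ H) (hi : 0 ≤ i) (hj : 0 ≤ j)
    (hi' : i ≤ (H + d) * (2 * τ + 1) + τ - 2) (hj' : j ≤ (H + d) * (2 * τ + 1) + τ - 2)
    (he : j - i = (2 * τ + 1) * e)
    (hM : i + j = (H * (2 * τ + 1) - 1) * M + 2 * (d * (2 * τ + 1) + 2 * τ)) :
    -(2 * d) ≤ H * M - e ∧ H * M - e ≤ 2 * H - 3 := by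
  have hQ : 0 ≤ H * (2 * τ + 1) - 1 := by nlinarith
  have hM0 : 0 ≤ M := by
    by_contra! h
    nlinarith [mul_nonneg hQ (show 0 ≤ -1 - M by omega),
      mul_nonneg (show 0 ≤ H - 2 * d - 2 by omega) (show 0 ≤ 2 * τ + 1 by omega)]
  have hM1 : M ≤ 1 := by
    by_contra! h
    nlinarith [mul_nonneg hQ (show 0 ≤ M - 2 by omega)]
  obtain rfl | rfl : M = 0 ∨ M = 1 := by omega
  · have hpar : e = 2 * (d * (2 * τ + 1) + 2 * τ - i - τ * e) := by linarith
    have h1 : e < 2 * d + 2 := by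
      by_contra! h
      nlinarith
    have h2 : -(2 * d + 2) < e := by
      by_contra! h
      nlinarith
    omega
  · have hpar : H - 1 - e = 2 * (i - d * (2 * τ + 1) - 2 * τ - τ * (H - e)) := by linarith
    have h1 : e < H - 1 := by
      by_contra! h
      nlinarith
    have h2 : -(H - 1) < e := by
      by_contra! h
      nlinarith
    omega

theorem bounds_of_le_two_mul_add_one {H d τ i j e M : ℤ} (hτ : 1 ≤ τ)
    (hH : 2 ≤ H) (hdH : 2 * d ≤ H) (hi : 0 ≤ i) (hj : 0 ≤ j)
    (hi' : i ≤ (H + d) * (2 * τ + 1) + τ - 2) (hj' : j ≤ (H + d) * (2 * τ + 1) + τ - 2)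
    (he : j - i = (2 * τ + 1) * e)
    (hM : i + j = (H * (2 * τ + 1) - 1) * M + 2 * ((d - 1) * (2 * τ + 1) + 2 * τ)) :
    Even (H * M - e) ∧ -(2 * d - 2) ≤ H * M - e ∧ H * M - e ≤ 2 * d - 2 ∨
      Odd (H * M - e) ∧ 1 ≤ H * M - e ∧ H * M - e ≤ 2 * H - 1 ∨ H * M - e = 2 * H := by
  have hQ : 0 ≤ H * (2 * τ + 1) - 1 := by nlinarith
  have hM0 : 0 ≤ M := by
    by_contra! h
    nlinarith [mul_nonneg hQ (show 0 ≤ -1 - M by omega),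
      mul_nonneg (show 0 ≤ H - 2 * d by omega) (show 0 ≤ 2 * τ + 1 by omega)]
  have hM2 : M ≤ 2 := by
    by_contra! h
    nlinarith [mul_nonneg hQ (show 0 ≤ M - 3 by omega)]
  rw [Int.even_iff, Int.odd_iff]
  obtain rfl | rfl | rfl : M = 0 ∨ M = 1 ∨ M = 2 := by omega
  · left
    have hpar : e = 2 * ((d - 1) * (2 * τ + 1) + 2 * τ - i - τ * e) := by linarith
    have h1 : e < 2 * d := by
      by_contra! h
      nlinarith
    have h2 : -(2 * d) < e := by
      by_contra! h
      nlinarith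
    omega
  · right
    left
    have hpar : H - 1 - e = 2 * (i - (d - 1) * (2 * τ + 1) - 2 * τ - τ * (H - e)) := by linarith
    have h1 : e < H + 1 := by
      by_contra! h
      nlinarith
    have h2 : -(H + 1) < e := by
      by_contra! h
      nlinarith
    omega
  · right
    right
    have h1 : e < 1 := by
      by_contra! h
      nlinarith
    have h2 : -1 < e := by
      by_contra! h
      nlinarith
    omega

theorem exists_grs_of_weights {F : Type*} [Field F] [Fintype F] {q : ℕ} (hq : IsPrimePow q)
    (hF : Fintype.card F = q ^ 2) {ω : F} (hω : IsPrimitiveRoot ω (q ^ 2 - 1)) {g m : ℕ}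
    (hgm : q ^ 2 - 1 = g * m) (S : Finset ℕ) (hSg : S ⊆ range g) (hS : #S < q) (u : ℕ → F)
    (hu : ∀ s ∈ S, u s ≠ 0) (k t : ℕ)
    (hsum : ∀ i j c : ℕ, i < k → j < k → q * i + j + (q + 1) * t = c * m →
      ∑ s ∈ S, u s * ((ω ^ m) ^ c) ^ s = 0) :
    ∃ a v : Fin (#S * m) → F, Function.Injective a ∧ (∀ l, v l ≠ 0) ∧
      ∀ i j : ℕ, i < k → j < k → ∑ l, v l ^ (q + 1) * a l ^ (q * i + j) = 0 := by
  have hq1 : 1 < q := hq.one_lt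
  have hq2 : q < q ^ 2 := by nlinarith
  have hpos : 0 < q ^ 2 - 1 := by omega
  have hω0 : ω ≠ 0 := hω.ne_zero hpos.ne'
  let A : Set ℕ := {N | (∃ i j, i < k ∧ j < k ∧ N = q * i + j + (q + 1) * t) ∧ m ∣ N}
  obtain ⟨w, hw, hwq, hwsum⟩ := exists_fixed_of_sum_mul_pow_eq_zero hq hF S hS ω A (by
    rintro N ⟨⟨i, j, hi, hj, rfl⟩, hm⟩
    have e : q * (q * j + i + (q + 1) * t) =
        q * i + j + (q + 1) * t + (q ^ 2 - 1) * (j + t) := by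
      zify [show 1 ≤ q ^ 2 by omega]
      ring
    refine ⟨q * j + i + (q + 1) * t, ⟨⟨j, i, hj, hi, rfl⟩, ?_⟩, ?_⟩
    · have hcop : Nat.Coprime m q := by
        refine Nat.Coprime.coprime_dvd_left ⟨g, by rw [hgm, mul_comm]⟩ (?_ : (q ^ 2 - 1).Coprime q)
        rw [← Nat.isCoprime_iff_coprime]
        refine ⟨-1, q, ?_⟩
        push_cast [show 1 ≤ q ^ 2 by omega]
        ring
      refine hcop.dvd_of_dvd_mul_left (e ▸ dvd_add hm ?_)
      rw [hgm]
      exact Dvd.dvd.mul_right (dvd_mul_left m g) _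
    · rw [e, pow_add, pow_mul, hω.pow_eq_one, one_pow, mul_one]) u hu (by
    rintro N ⟨⟨i, j, hi, hj, rfl⟩, c, hc⟩
    rw [hc, pow_mul]
    exact hsum i j c hi hj (by rw [hc, mul_comm]))
  let b : S × Fin m → F := fun x => ω ^ (x.1.1 + g * x.2.1)
  have hb0 : ∀ x, b x ≠ 0 := fun x => pow_ne_zero _ hω0
  have hbinj : Function.Injective b := by
    rintro ⟨⟨s, hs⟩, l, hl⟩ ⟨⟨s', hs'⟩, l', hl'⟩ h
    have h1 := mem_range.1 (hSg hs)
    have h2 := mem_range.1 (hSg hs')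
    have h3 : s + g * l = s' + g * l' :=
      hω.pow_inj (by rw [hgm]; nlinarith) (by rw [hgm]; nlinarith) h
    have h4 : s = s' := by
      have := congrArg (· % g) h3
      simpa [Nat.mod_eq_of_lt h1, Nat.mod_eq_of_lt h2] using this
    subst h4
    have h5 : l = l' := Nat.eq_of_mul_eq_mul_left (by omega : 0 < g) (by omega)
    subst h5
    rfl
  have hv : ∀ x : S × Fin m, ∃ v : F, v ≠ 0 ∧ v ^ (q + 1) = w x.1 * (b x ^ (q + 1)) ^ t := by
    intro x
    refine exists_pow_succ_eq_of_pow_eq hq1 hF hω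
      (mul_ne_zero (hw _ x.1.2) (pow_ne_zero _ (pow_ne_zero _ (hb0 x)))) ?_
    have : (b x ^ (q + 1)) ^ q = b x ^ (q + 1) := by
      have h := FiniteField.pow_card (b x)
      rw [hF] at h
      calc (b x ^ (q + 1)) ^ q = b x ^ q ^ 2 * b x ^ q := by ring
        _ = _ := by rw [h]; ring
    rw [mul_pow, hwq, ← pow_mul, mul_comm t q, pow_mul, this]
  choose v hv0 hvp using hv
  let φ : Fin (#S * m) ≃ S × Fin m := (Fintype.equivFinOfCardEq (by simp)).symm
  refine ⟨b ∘ φ, v ∘ φ, hbinj.comp φ.injective, fun l => hv0 _, fun i j hi hj => ?_⟩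
  simp only [Function.comp_apply]
  rw [φ.sum_comp fun x => v x ^ (q + 1) * b x ^ (q * i + j)]
  set N := q * i + j + (q + 1) * t with hN
  have h1 : ∀ x, v x ^ (q + 1) * b x ^ (q * i + j) =
      w x.1 * (ω ^ N) ^ (x.1 : ℕ) * (ω ^ (g * N)) ^ (x.2 : ℕ) := by
    intro x
    rw [hvp, ← pow_mul, mul_assoc, ← pow_add, mul_assoc]
    simp only [b, ← pow_mul, ← pow_add, hN]
    congr 2
    ring
  simp only [h1]
  rw [Fintype.sum_prod_type]
  simp only [← mul_sum]
  rw [← sum_mul, sum_coe_sort S fun s => w s * (ω ^ N) ^ s,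
    Fin.sum_univ_eq_sum_range fun l => (ω ^ (g * N)) ^ l]
  by_cases hm : m ∣ N
  · rw [hwsum N ⟨⟨i, j, hi, hj, rfl⟩, hm⟩, zero_mul]
  · have hne : ω ^ (g * N) ≠ 1 := by
      intro h
      have := hω.dvd_of_pow_eq_one _ h
      rw [hgm] at this
      refine hm (Nat.dvd_of_mul_dvd_mul_left (Nat.pos_of_ne_zero ?_) this)
      rintro rfl
      simp at hgm
      omega
    have h2 := geom_sum_mul (ω ^ (g * N)) m
    have hone : (ω ^ (g * N)) ^ m = 1 := by
      rw [← pow_mul, mul_right_comm, ← hgm, pow_mul, hω.pow_eq_one, one_pow]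
    rw [hone, sub_self] at h2
    rw [(mul_eq_zero.1 h2).resolve_right (sub_ne_zero.2 hne), mul_zero]

theorem exists_weights_of_mul_add_sub_eq {F : Type*} [Field F] [Fintype F] (h2 : (2 : F) ≠ 0)
    {q H d τ k : ℕ} (hH : 2 ≤ H) (hd : 1 ≤ d) (hdH : 2 * d ≤ H) (hτ : 1 ≤ τ) {ζ : F}
    (hζ : IsPrimitiveRoot ζ (4 * H)) (hcard : 2 * H + 2 * d < Fintype.card F)
    (hq : (q : ℤ) = 2 * H * (2 * τ + 1) - 1)
    (hk : (k : ℤ) ≤ (H + d) * (2 * τ + 1) + τ - 1) :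
    ∃ S ⊆ range (4 * H), #S = 2 * H + 2 * d - 1 ∧
      ∃ u : ℕ → F, (∀ s ∈ S, u s ≠ 0) ∧ ∃ s₀ ≤ q - 1, ∀ i j : ℕ, i < k → j < k → ∀ c : ℤ,
        ((2 * H * (2 * τ + 1) - 1) * i + j - 2 * H * (2 * τ + 1) * s₀ : ℤ) =
          c * ((2 * τ + 1) * (H * (2 * τ + 1) - 1)) →
        ∑ s ∈ S, u s * ζ ^ ((s : ℤ) * c) = 0 := by
  have hρ0 : (2 * τ + 1 : ℤ) ≠ 0 := by omega
  have hQ0 : (H * (2 * τ + 1) - 1 : ℤ) ≠ 0 := by nlinarith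
  have hs (a : ℕ) (ha : a + 2 ≤ 2 * H) : a * (2 * τ + 1) + 2 * τ ≤ q - 1 := by
    have h1 := Nat.mul_le_mul_right (2 * τ + 1) ha
    have h3 : q + 1 = 2 * H * (2 * τ + 1) := by
      zify
      linarith
    rw [← h3, add_mul] at h1
    omega
  rcases le_or_gt (2 * d + 2) H with hlt | hlt
  · obtain ⟨u, hu, hsum⟩ := exists_weights_range hζ
      (show 2 * H + 2 * d - 1 ≤ 4 * H by omega) (-(2 * (d : ℤ)))
    refine ⟨_, range_subset_range.2 (by omega), card_range _, u, hu, d * (2 * τ + 1) + 2 * τ,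
      hs d (by omega), fun i j hi hj c hc => ?_⟩
    obtain ⟨e, M, he, hM, rfl⟩ := exists_eq_of_mul_add_sub_eq hρ0 hQ0 hc
    have := bounds_of_two_mul_add_two_le (H := H) (d := d) (τ := τ) (i := i) (j := j) (M := M)
      (by omega) (by omega) (by omega) (by omega) (by omega) (by linarith) (by linarith) he
      (by rw [hM]; push_cast; ring)
    exact hsum _ this.1 (by omega)
  · obtain ⟨S, hSr, hSc, u, hu, hsum⟩ := exists_weights_of_le_two_mul_add_one h2 hH hdH
      (by omega) hζ hcard
    refine ⟨S, hSr, hSc, u, hu, (d - 1) * (2 * τ + 1) + 2 * τ, hs (d - 1) (by omega),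
      fun i j hi hj c hc => ?_⟩
    obtain ⟨e, M, he, hM, rfl⟩ := exists_eq_of_mul_add_sub_eq hρ0 hQ0 hc
    exact hsum _ (bounds_of_le_two_mul_add_one (H := H) (d := d) (τ := τ) (i := i) (j := j)
      (by omega) (by omega) (by omega) (by omega) (by omega) (by linarith) (by linarith) he
      (by rw [hM]; push_cast [hd]; ring))

theorem thm_qplus_len_no_plus_one_case2
    (q h τ r n : ℕ) (hq : IsPrimePow q) (hqo : Odd q)
    (hh : 0 < h) (hhe : Even h) (hτ : 1 ≤ τ)
    (hdiv : q + 1 = h * (2 * τ + 1))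
    (hro : Odd r) (hr1 : h < r) (hr2 : 2 * r < 3 * h)  -- i.e. odd r, h < r < 3h/2
    -- n = r(q²-1)/(2h)
    (hn : 2 * h * n = r * (q ^ 2 - 1))
    (k : ℕ) (hk1 : 1 ≤ k)
    -- k ≤ (r+2)(q+1)/(2h) - 3/2
    (hk : 2 * h * k + 3 * h ≤ (r + 2) * (q + 1))
    (F : Type*) [Field F] [Fintype F] (hF : Fintype.card F = q ^ 2) :
    ∃ a v : Fin n → F, Function.Injective a ∧ (∀ l, v l ≠ 0) ∧
      ∀ i j : ℕ, i < k → j < k →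
        ∑ l, v l ^ (q + 1) * a l ^ (q * i + j) = 0 := by
  obtain ⟨H, rfl⟩ := hhe
  obtain ⟨d, hd, rfl⟩ : ∃ d, 1 ≤ d ∧ r = 2 * H + 2 * d - 1 := by
    obtain ⟨y, rfl⟩ := hro
    exact ⟨y + 1 - H, by omega, by omega⟩
  have hdH : 2 * d ≤ H := by omega
  have hH : 2 ≤ H := by omega
  have hρ6 : 6 * H ≤ q + 1 := by nlinarith
  have hqZ : (q : ℤ) = 2 * H * (2 * τ + 1) - 1 := by
    have : (q : ℤ) + 1 = (H + H) * (2 * τ + 1) := by exact_mod_cast hdiv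
    linarith
  have hkZ : (k : ℤ) ≤ (H + d) * (2 * τ + 1) + τ - 1 := by
    have h1 : (2 * (H + H) * k + 3 * (H + H) : ℤ) ≤
        (2 * H + 2 * d + 1) * ((H + H) * (2 * τ + 1)) := by
      have h2 : 2 * H + 2 * d - 1 + 2 = 2 * H + 2 * d + 1 := by omega
      rw [hdiv, h2] at hk
      exact_mod_cast hk
    have h3 : (2 * k + 3 : ℤ) ≤ (2 * H + 2 * d + 1) * (2 * τ + 1) := by
      refine le_of_mul_le_mul_left ?_ (show (0 : ℤ) < H + H by omega)
      linarith
    linarith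
  have hQ1 : 1 ≤ H * (2 * τ + 1) := by nlinarith
  set m : ℕ := (2 * τ + 1) * (H * (2 * τ + 1) - 1) with hm
  have hmZ : (m : ℤ) = (2 * τ + 1) * (H * (2 * τ + 1) - 1) := by
    rw [hm]
    push_cast [hQ1]
    ring
  have hq1 : 1 < q := hq.one_lt
  have hq2 : 1 ≤ q ^ 2 := Nat.one_le_pow _ _ (by omega)
  have hgm : q ^ 2 - 1 = 4 * H * m := by
    zify [hq2]
    rw [hmZ, hqZ]
    ring
  obtain rfl : n = (2 * H + 2 * d - 1) * m := by
    rw [hgm] at hn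
    refine Nat.eq_of_mul_eq_mul_left (show 0 < 4 * H by omega) ?_
    linarith
  have hpos : 0 < q ^ 2 - 1 := by
    have : q < q ^ 2 := by nlinarith
    omega
  classical
  obtain ⟨ω, hω⟩ : ∃ ω : F, IsPrimitiveRoot ω (q ^ 2 - 1) := by
    obtain ⟨y, hy⟩ := IsCyclic.exists_generator (α := Fˣ)
    refine ⟨y, IsPrimitiveRoot.coe_units_iff.2 ?_⟩
    have : q ^ 2 - 1 = orderOf y := by
      rw [orderOf_eq_card_of_forall_mem_zpowers hy, Nat.card_eq_fintype_card, Fintype.card_units, hF]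
    exact this ▸ IsPrimitiveRoot.orderOf y
  have hω0 : ω ≠ 0 := hω.ne_zero hpos.ne'
  have hζ : IsPrimitiveRoot (ω ^ m) (4 * H) := hω.pow hpos (by rw [hgm, mul_comm])
  have h2 : (2 : F) ≠ 0 := by
    refine Ring.two_ne_zero (fun hc => ?_)
    have := FiniteField.even_card_iff_char_two.1 hc
    rw [hF, ← Nat.even_iff] at this
    exact Nat.not_even_iff_odd.2 hqo.pow this
  have hcard : 2 * H + 2 * d < Fintype.card F := by
    rw [hF]
    nlinarith
  obtain ⟨S, hSr, hSc, u, hu, s₀, hs₀, hsum⟩ :=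
    exists_weights_of_mul_add_sub_eq h2 hH hd hdH hτ hζ hcard hqZ hkZ
  rw [← hSc]
  refine exists_grs_of_weights hq hF hω hgm S hSr (by omega) u hu k (q - 1 - s₀)
    fun i j c hi hj hc => ?_
  have hcZ : (q * i + j + (q + 1) * (q - 1 - s₀) : ℤ) = c * m := by
    zify [hs₀, hq1.le] at hc
    exact hc
  rw [← hsum i j hi hj (c - 4 * H) (by
    have hqm : ((q : ℤ) + 1) * (q - 1) = 4 * H * m := by
      rw [hmZ, hqZ]
      ring
    rw [← hmZ]
    linear_combination hcZ - hqm - (i - s₀ : ℤ) * hqZ)]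
  refine sum_congr rfl fun s _ => ?_
  have h4 : (ω ^ m) ^ (4 * (H : ℤ)) = 1 := by exact_mod_cast hζ.pow_eq_one
  rw [mul_comm (s : ℤ), zpow_mul, zpow_sub₀ (pow_ne_zero _ hω0), h4, div_one, zpow_natCast,
    zpow_natCast]
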